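/- For every finite simple graph H with no isolated vertex, γ(H) ≤ |V(H)| − ν(H), where ν(H) is the number of connected components of H. Moreover, equality γ(H) = |V(H)| − ν(H) holds if and only if H is a disjoint union of stars, i.e., every connected component of H is isomorphic to a star K_{1,m} for some m ≥ 1. -/

import Mathlib

open SimpleGraph

/-- `graphDelta H = δ(H) = max_{S ⊆ V(H)} (|S| - |N_H(S)|)`. -/
noncomputable def graphDelta {V : Type*} (H : SimpleGraph V) : ℤ :=
  sSup {d : ℤ | ∃ S : Set V,
    d = (Nat.card S : ℤ) - (Nat.card {v : V | ∃ u ∈ S, H.Adj u v} : ℤ)}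

/-- `gammaE H = γ(H) = (|V(H)| + δ(H))/2`. -/
noncomputable def gammaE {V : Type*} [Fintype V] (H : SimpleGraph V) : ℝ :=
  ((Fintype.card V : ℝ) + (graphDelta H : ℝ)) / 2


namespace Stmt7Aux

open Classical in
noncomputable def fib {V : Type} [Fintype V] (H : SimpleGraph V) (X : Set V)
    (C : H.ConnectedComponent) : Finset V :=
  Finset.univ.filter (fun v => v ∈ X ∧ H.connectedComponentMk v = C)

def nbr {V : Type} (H : SimpleGraph V) (S : Set V) : Set V := {v : V | ∃ u ∈ S, H.Adj u v}

def IsStar {V : Type} (H : SimpleGraph V) (C : H.ConnectedComponent) (c : V) : Prop :=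
  H.connectedComponentMk c = C ∧
    ∀ v, H.connectedComponentMk v = C → v ≠ c → ∀ u, H.Adj v u → u = c

variable {V : Type} [Fintype V] (H : SimpleGraph V)

lemma mem_fib {X : Set V} {C : H.ConnectedComponent} {v : V} :
    v ∈ fib H X C ↔ v ∈ X ∧ H.connectedComponentMk v = C := by
  simp [fib]

lemma mk_adj {u v : V} (h : H.Adj u v) :
    H.connectedComponentMk u = H.connectedComponentMk v :=
  ConnectedComponent.sound h.reachable

open Classical in
lemma sum_fib (X : Set V) : Nat.card X = ∑ C : H.ConnectedComponent, (fib H X C).card := by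
  rw [Nat.card_eq_fintype_card, ← Set.toFinset_card,
    Finset.card_eq_sum_card_fiberwise (f := H.connectedComponentMk) (t := Finset.univ)
      (by intro x _; simp)]
  refine Finset.sum_congr rfl fun C _ => ?_
  congr 1
  ext v
  simp [mem_fib]

lemma two_le (hiso : ∀ v : V, ∃ u, H.Adj v u) (S : Set V) (C : H.ConnectedComponent) :
    2 ≤ (fib H Sᶜ C).card + (fib H (nbr H S) C).card := by
  classical
  obtain ⟨v, rfl⟩ := C.exists_rep
  change 2 ≤ (fib H Sᶜ (H.connectedComponentMk v)).card +
    (fib H (nbr H S) (H.connectedComponentMk v)).card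
  obtain ⟨u, huv⟩ := hiso v
  have hc := mk_adj H huv
  have pair : ∀ T : Finset V, u ∈ T → v ∈ T → 2 ≤ T.card := fun T h1 h2 =>
    Finset.one_lt_card.2 ⟨u, h1, v, h2, huv.ne'⟩
  by_cases hu : u ∈ S <;> by_cases hv : v ∈ S
  · have := pair (fib H (nbr H S) (H.connectedComponentMk v))
      ((mem_fib H).2 ⟨⟨v, hv, huv⟩, hc.symm⟩) ((mem_fib H).2 ⟨⟨u, hu, huv.symm⟩, rfl⟩)
    omega
  · have h1 := Finset.card_pos.2 ⟨v, (mem_fib H (X := Sᶜ)).2 ⟨hv, rfl⟩⟩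
    have h2 := Finset.card_pos.2 ⟨v, (mem_fib H (X := nbr H S)).2 ⟨⟨u, hu, huv.symm⟩, rfl⟩⟩
    omega
  · have h1 := Finset.card_pos.2 ⟨u, (mem_fib H (X := Sᶜ)).2 ⟨hu, hc.symm⟩⟩
    have h2 := Finset.card_pos.2 ⟨u, (mem_fib H (X := nbr H S)).2 ⟨⟨v, hv, huv⟩, hc.symm⟩⟩
    omega
  · have := pair (fib H Sᶜ (H.connectedComponentMk v))
      ((mem_fib H).2 ⟨hu, hc.symm⟩) ((mem_fib H).2 ⟨hv, rfl⟩)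
    omega

lemma star_of_card_two (X : Set V) (C : H.ConnectedComponent)
    (hX : ∀ v, H.connectedComponentMk v = C → v ∈ X) (h : (fib H X C).card = 2) :
    ∃ c, IsStar H C c := by
  classical
  obtain ⟨x, y, hxy, hs⟩ := Finset.card_eq_two.1 h
  have hm : ∀ v, H.connectedComponentMk v = C → v = x ∨ v = y := by
    intro v hv
    have := (mem_fib H).2 ⟨hX v hv, hv⟩
    rw [hs] at this
    simpa using this
  have hx : x ∈ fib H X C := by rw [hs]; simp
  refine ⟨x, ((mem_fib H).1 hx).2, fun v hv hne u huv => ?_⟩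
  have h1 := hm v hv
  have h2 := hm u ((mk_adj H huv).symm.trans hv)
  have h3 := huv.ne
  grind

lemma star_of_eq (hiso : ∀ v : V, ∃ u, H.Adj v u) (S : Set V) (C : H.ConnectedComponent)
    (h : (fib H Sᶜ C).card + (fib H (nbr H S) C).card = 2) : ∃ c, IsStar H C c := by
  classical
  rcases Nat.eq_zero_or_pos (fib H Sᶜ C).card with hA | hA
  · rw [Finset.card_eq_zero] at hA
    have hS : ∀ v, H.connectedComponentMk v = C → v ∈ S := by
      intro v hv
      by_contra hn
      have := (mem_fib H (X := Sᶜ)).2 ⟨hn, hv⟩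
      simp [hA] at this
    refine star_of_card_two H (nbr H S) C (fun v hv => ?_) (by simpa [hA] using h)
    obtain ⟨u, hu⟩ := hiso v
    exact ⟨u, hS u ((mk_adj H hu).symm.trans hv), hu.symm⟩
  rcases Nat.eq_zero_or_pos (fib H (nbr H S) C).card with hB | hB
  · rw [Finset.card_eq_zero] at hB
    refine star_of_card_two H Sᶜ C (fun v hv hn => ?_) (by simpa [hB] using h)
    obtain ⟨u, hu⟩ := hiso v
    have := (mem_fib H (X := nbr H S)).2 ⟨⟨v, hn, hu⟩, (mk_adj H hu).symm.trans hv⟩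
    simp [hB] at this
  obtain ⟨c, hc⟩ := Finset.card_eq_one.1 (by omega : (fib H Sᶜ C).card = 1)
  obtain ⟨w, hw⟩ := Finset.card_eq_one.1 (by omega : (fib H (nbr H S) C).card = 1)
  have hcA : c ∉ S ∧ H.connectedComponentMk c = C := (mem_fib H (X := Sᶜ)).1 (by rw [hc]; simp)
  have hA' : ∀ v, H.connectedComponentMk v = C → v ≠ c → v ∈ S := by
    intro v hv hne
    by_contra hn
    have := (mem_fib H (X := Sᶜ)).2 ⟨hn, hv⟩
    rw [hc] at this
    exact hne (by simpa using this)
  have hB' : ∀ v u, H.connectedComponentMk v = C → v ∈ S → H.Adj v u → u = w := by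
    intro v u hv hvS huv
    have := (mem_fib H (X := nbr H S)).2 ⟨⟨v, hvS, huv⟩, (mk_adj H huv).symm.trans hv⟩
    rw [hw] at this
    simpa using this
  have hcw : c = w := by
    obtain ⟨u, hu⟩ := hiso c
    have hu' := (mk_adj H hu).symm.trans hcA.2
    exact hB' u c hu' (hA' u hu' hu.ne') hu.symm
  refine ⟨c, hcA.2, fun v hv hne u huv => ?_⟩
  rw [hcw]
  exact hB' v u hv (hA' v hv hne) huv

lemma eq_of_star (hiso : ∀ v : V, ∃ u, H.Adj v u) (h : ∀ C, ∃ c, IsStar H C c) :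
    ∃ S : Set V, ∀ C, (fib H Sᶜ C).card + (fib H (nbr H S) C).card = 2 := by
  classical
  choose c hc using h
  refine ⟨{v | v ≠ c (H.connectedComponentMk v)}, fun C => ?_⟩
  have h1 : fib H {v | v ≠ c (H.connectedComponentMk v)}ᶜ C = {c C} := by
    ext v
    simp only [mem_fib, Set.mem_compl_iff, Set.mem_setOf_eq, not_not, Finset.mem_singleton]
    constructor
    · rintro ⟨h1, h2⟩
      rw [h2] at h1
      exact h1
    · rintro rfl
      have := (hc C).1
      exact ⟨by rw [this], this⟩
  have h2 : fib H (nbr H {v | v ≠ c (H.connectedComponentMk v)}) C = {c C} := by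
    ext v
    simp only [mem_fib, nbr, Set.mem_setOf_eq, Finset.mem_singleton]
    constructor
    · rintro ⟨⟨u, hu, huv⟩, h2⟩
      have hu' := (mk_adj H huv).trans h2
      rw [hu'] at hu
      exact (hc C).2 u hu' hu v huv
    · rintro rfl
      have := (hc C).1
      obtain ⟨u, hu⟩ := hiso (c C)
      refine ⟨⟨u, ?_, hu.symm⟩, this⟩
      rw [← mk_adj H hu, this]
      exact hu.ne'
  rw [h1, h2]
  simp

open Classical in
lemma star_iff (hiso : ∀ v : V, ∃ u, H.Adj v u) (C : H.ConnectedComponent) :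
    (∃ c, IsStar H C c) ↔ ∃ m : ℕ, 1 ≤ m ∧
        Nonempty ((H.induce C.supp) ≃g completeBipartiteGraph Unit (Fin m)) := by
  constructor
  · rintro ⟨c, hc, hs⟩
    let c' : C.supp := ⟨c, hc⟩
    obtain ⟨u, hu⟩ := hiso c
    have huC : H.connectedComponentMk u = C := (mk_adj H hu).symm.trans hc
    let L := {x : C.supp // ¬ x = c'}
    have hadj : ∀ v, H.connectedComponentMk v = C → v ≠ c → H.Adj v c := by
      intro v hv hne
      obtain ⟨w, hw⟩ := hiso v
      have := hs v hv hne w hw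
      exact this ▸ hw
    let e : C.supp ≃ Unit ⊕ Fin (Fintype.card L) :=
      (Equiv.sumCompl (fun x : C.supp => x = c')).symm.trans
        (Equiv.sumCongr (Equiv.ofUnique _ _) (Fintype.equivFin L))
    refine ⟨Fintype.card L, Fintype.card_pos_iff.2 ⟨⟨⟨u, huC⟩, fun h => hu.ne' ?_⟩⟩, ⟨⟨e, ?_⟩⟩⟩
    · exact congrArg Subtype.val h
    · have el : ∀ x : C.supp, x = c' → (e x).isLeft = true := by
        intro x hx
        simp [e, Equiv.sumCompl_symm_apply_of_pos, hx]
      have er : ∀ x : C.supp, x ≠ c' → (e x).isLeft = false := by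
        intro x hx
        simp [e, Equiv.sumCompl_symm_apply_of_neg, hx]
      have hne : ∀ x : C.supp, x ≠ c' → x.1 ≠ c := fun x hx h => hx (Subtype.ext h)
      intro x y
      rw [completeBipartiteGraph_adj, comap_adj]
      have r : ∀ z : C.supp, (e z).isRight = !(e z).isLeft := fun z => by
        cases e z <;> rfl
      simp only [r]
      by_cases hx : x = c' <;> by_cases hy : y = c'
      · simp [el x hx, el y hy, hx, hy]
      · simp only [el x hx, er y hy]
        subst hx
        simpa using (hadj y.1 y.2 (hne y hy)).symm
      · simp only [er x hx, el y hy]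
        subst hy
        simpa using (hadj x.1 x.2 (hne x hx))
      · simp only [er x hx, er y hy]
        have := fun h => hne y hy (hs x.1 x.2 (hne x hx) y.1 h)
        simpa using this
  · rintro ⟨m, -, ⟨φ⟩⟩
    refine ⟨(φ.symm (Sum.inl ())).1, (φ.symm (Sum.inl ())).2, fun v hv hne u huv => ?_⟩
    have hu : H.connectedComponentMk u = C := (mk_adj H huv).symm.trans hv
    have hA : (completeBipartiteGraph Unit (Fin m)).Adj (φ ⟨v, hv⟩) (φ ⟨u, hu⟩) :=
      φ.map_adj_iff.2 (by simpa using huv)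
    rcases h1 : φ ⟨v, hv⟩ with a | a
    · exfalso
      apply hne
      rw [← show φ ⟨v, hv⟩ = Sum.inl () from h1]
      simp
    · rcases h2 : φ ⟨u, hu⟩ with b | b
      · rw [← show φ ⟨u, hu⟩ = Sum.inl () from h2]
        simp
      · rw [h1, h2] at hA
        simp at hA

open Classical in
lemma count (S : Set V) : (Nat.card S : ℤ) - (Nat.card (nbr H S) : ℤ) =
    Fintype.card V - ∑ C : H.ConnectedComponent,
      (((fib H Sᶜ C).card + (fib H (nbr H S) C).card : ℕ) : ℤ) := by
  have h1 := sum_fib H Sᶜ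
  have h2 := sum_fib H (nbr H S)
  have h3 : Nat.card S + Nat.card (Sᶜ : Set V) = Fintype.card V := by
    rw [← Nat.card_eq_fintype_card]
    exact Set.ncard_add_ncard_compl S
  push_cast
  rw [Finset.sum_add_distrib]
  zify at h1 h2 h3
  rw [← h1, ← h2, ← h3]
  ring

end Stmt7Aux

open Stmt7Aux in
/-- For every finite simple graph H with no isolated vertex, γ(H) ≤ |V(H)| − ν(H), with
equality if and only if every connected component of H is a star K_{1,m} for some m ≥ 1. -/
theorem stmt7 {V : Type} [Fintype V] (H : SimpleGraph V)
    (hiso : ∀ v : V, ∃ u, H.Adj v u) :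
    gammaE H ≤ (Fintype.card V : ℝ) - (Nat.card H.ConnectedComponent : ℝ) ∧
    (gammaE H = (Fintype.card V : ℝ) - (Nat.card H.ConnectedComponent : ℝ) ↔
      ∀ C : H.ConnectedComponent, ∃ m : ℕ, 1 ≤ m ∧
        Nonempty ((H.induce C.supp) ≃g completeBipartiteGraph Unit (Fin m))) := by
  classical
  simp only [← star_iff H hiso]
  obtain ⟨n, hn⟩ : ∃ n : ℤ, n = (Fintype.card V : ℤ) := ⟨_, rfl⟩
  obtain ⟨k, hk⟩ : ∃ k : ℤ, k = (Nat.card H.ConnectedComponent : ℤ) := ⟨_, rfl⟩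
  have hk2 : ∑ C : H.ConnectedComponent, (2 : ℤ) = 2 * k := by
    simp [hk, Nat.card_eq_fintype_card, mul_comm]
  have hle : ∀ S : Set V, (Nat.card S : ℤ) - (Nat.card (nbr H S) : ℤ) ≤ n - 2 * k := by
    intro S
    rw [count, ← hk2, ← hn]
    have := Finset.sum_le_sum (s := Finset.univ) fun (C : H.ConnectedComponent) _ =>
      (Int.ofNat_le.2 (two_le H hiso S C))
    simp only [Nat.cast_ofNat] at this
    exact sub_le_sub_left this _
  set D : Set ℤ := {d : ℤ | ∃ S : Set V,
    d = (Nat.card S : ℤ) - (Nat.card {v : V | ∃ u ∈ S, H.Adj u v} : ℤ)} with hD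
  have hbdd : BddAbove D := ⟨n - 2 * k, by rintro d ⟨S, rfl⟩; exact hle S⟩
  have hmem : graphDelta H ∈ D := Int.csSup_mem ⟨_, ∅, rfl⟩ hbdd
  obtain ⟨S, hS⟩ := hmem
  have hdle : graphDelta H ≤ n - 2 * k := hS ▸ hle S
  have key : graphDelta H = n - 2 * k ↔ ∀ C, ∃ c, IsStar H C c := by
    constructor
    · intro he C
      have h1 := hS.symm.trans he
      have h2 := (count H S).symm.trans h1
      rw [← hk2, ← hn] at h2
      have h3 := sub_right_injective h2
      have h4 := (Finset.sum_eq_sum_iff_of_le (fun (C : H.ConnectedComponent) _ =>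
        (Int.ofNat_le.2 (two_le H hiso S C)))).1 (by simpa using h3.symm) C (Finset.mem_univ C)
      exact star_of_eq H hiso S C (by exact_mod_cast h4.symm)
    · intro h
      obtain ⟨T, hT⟩ := eq_of_star H hiso h
      refine le_antisymm hdle ?_
      have : n - 2 * k = (Nat.card T : ℤ) - (Nat.card (nbr H T) : ℤ) := by
        rw [count, ← hk2, ← hn]
        simp only [hT, Nat.cast_ofNat]
      rw [this]
      exact le_csSup hbdd ⟨T, rfl⟩
  have hnR : (Fintype.card V : ℝ) = (n : ℝ) := by simp [hn]
  have hkR : (Nat.card H.ConnectedComponent : ℝ) = (k : ℝ) := by simp [hk]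
  rw [← key, gammaE, hnR, hkR]
  constructor
  · have : (graphDelta H : ℝ) ≤ n - 2 * k := by exact_mod_cast hdle
    linarith
  · constructor
    · intro h
      have : (graphDelta H : ℝ) = n - 2 * k := by linarith
      exact_mod_cast this
    · intro h
      have : (graphDelta H : ℝ) = n - 2 * k := by exact_mod_cast h
      linarith
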